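/- Per-variable pruning in the general case (Theorem 3.4, pruning part): fix a partition index k and an index i ∈ P_k, and let μ_k_i be the attained minimum of the reduced partial objective ∑ over j ∈ P_k, j ≠ i of a j * d j over assignments to P_k \ {i} that are injective there and satisfy the bound conditions (m j ≤ d j when 0 < a j, d j ≤ M j when a j < 0). Then every feasible assignment d with e(d) ≤ c satisfies a i * d i ≤ c − ∑ over j ≠ k of μ_j − μ_k_i; in particular, if 0 < a i this gives an upper bound on d i and if a i < 0 a lower bound on d i. -/

import Mathlib

/-- Per-variable pruning in the general case (Theorem 3.4, pruning part). -/
theorem stmt_15 (n s : ℕ) (a m M : Fin n → ℤ) (ha : ∀ i, a i ≠ 0) (c : ℤ)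
    (P : Fin s → Finset (Fin n))
    (hdisj : ∀ k l, k ≠ l → Disjoint (P k) (P l))
    (hcover : ∀ i : Fin n, ∃ k, i ∈ P k)
    (hsign : ∀ k, (∀ i ∈ P k, 0 < a i) ∨ (∀ i ∈ P k, a i < 0))
    (μ : Fin s → ℤ)
    (hμ_lb : ∀ k, ∀ d : Fin n → ℤ, Set.InjOn d (↑(P k)) →
      (∀ i ∈ P k, (0 < a i → m i ≤ d i) ∧ (a i < 0 → d i ≤ M i)) →
      μ k ≤ ∑ i ∈ P k, a i * d i)
    (hμ_att : ∀ k, ∃ d : Fin n → ℤ, (Set.InjOn d (↑(P k)) ∧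
      ∀ i ∈ P k, (0 < a i → m i ≤ d i) ∧ (a i < 0 → d i ≤ M i)) ∧
      ∑ i ∈ P k, a i * d i = μ k)
    (k : Fin s) (i : Fin n) (hik : i ∈ P k)
    (μki : ℤ)
    (hμki_lb : ∀ d : Fin n → ℤ, Set.InjOn d (↑((P k).erase i)) →
      (∀ j ∈ (P k).erase i, (0 < a j → m j ≤ d j) ∧ (a j < 0 → d j ≤ M j)) →
      μki ≤ ∑ j ∈ (P k).erase i, a j * d j)
    (hμki_att : ∃ d : Fin n → ℤ, (Set.InjOn d (↑((P k).erase i)) ∧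
      ∀ j ∈ (P k).erase i, (0 < a j → m j ≤ d j) ∧ (a j < 0 → d j ≤ M j)) ∧
      ∑ j ∈ (P k).erase i, a j * d j = μki) :
    ∀ d : Fin n → ℤ, (∀ k', Set.InjOn d (↑(P k'))) →
      (∀ j, (0 < a j → m j ≤ d j) ∧ (a j < 0 → d j ≤ M j)) →
      ∑ j, a j * d j ≤ c →
      a i * d i ≤ c - (∑ j ∈ Finset.univ.erase k, μ j) - μki := by
  intro d hinj hb hc
  have hU : (Finset.univ : Finset (Fin n)) = Finset.univ.biUnion P := by
    ext j
    simpa using hcover j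
  have hsum : ∑ j, a j * d j = ∑ l, ∑ j ∈ P l, a j * d j := by
    rw [hU, Finset.sum_biUnion (fun x _ y _ hxy => hdisj x y hxy)]
  have h1 := Finset.add_sum_erase Finset.univ (fun l => ∑ j ∈ P l, a j * d j) (Finset.mem_univ k)
  have h2 := Finset.add_sum_erase (P k) (fun j => a j * d j) hik
  have h3 : ∑ l ∈ Finset.univ.erase k, μ l ≤
      ∑ l ∈ Finset.univ.erase k, ∑ j ∈ P l, a j * d j :=
    Finset.sum_le_sum fun l _ => hμ_lb l d (hinj l) (fun j _ => hb j)
  have h4 := hμki_lb d ((hinj k).mono (by exact_mod_cast Finset.erase_subset i (P k)))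
    (fun j _ => hb j)
  linarith
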